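/- Let α > 1, 0 < α₁ < ⋯ < α_n < α, T > 0, and let a₀,…,a_n : ℚ_p⁴ × [0,T] → ℝ be non-negative, bounded, continuous functions and b : ℚ_p⁴ × [0,T] → ℝ a bounded continuous function. Let 0 ≤ λ < α₁ (if a₁ ≡ ⋯ ≡ a_n ≡ 0, assume only 0 ≤ λ < α). Suppose u is a solution of the homogeneous Cauchy problem ∂u(x,t)/∂t + a₀(x,t)(f(∂,α)u)(x,t) + Σ_{k=1}^n a_k(x,t)(f(∂,α_k)u)(x,t) + b(x,t)u(x,t) = 0 for x ∈ ℚ_p⁴, 0 < t ≤ T, with u(x,0) ≡ 0, such that u is continuous in (x,t), u(·,t) lies in the domain of each operator f(∂,α), f(∂,α_k) for t ∈ [0,T], u(x,·) is continuously differentiable on (0,T], and u(·,t) ∈ 𝔐_{2λ} uniformly in t. Then u(x,t) ≡ 0. -/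

import Mathlib

open MeasureTheory Real Filter Set

noncomputable section

namespace PadicParabolic

variable (p : ℕ) [Fact p.Prime]

instance : MeasurableSpace ℚ_[p] := borel _
instance : BorelSpace ℚ_[p] := ⟨rfl⟩

/-- The four dimensional vector space over `ℚ_[p]`, with the max-norm
`‖x‖ = max_{1 ≤ i ≤ 4} |x_i|_p`. -/
abbrev V (p : ℕ) [Fact p.Prime] := Fin 4 → ℚ_[p]

/-- `a` is a quadratic non-residue modulo `p`. -/
def IsQNR (a : ℤ) : Prop := ∀ b : ZMod p, b ^ 2 ≠ (a : ZMod p)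

/-- The elliptic quadratic form `f(x) = x₁² − a x₂² − p x₃² + a p x₄²`. -/
def qf (a : ℤ) (x : V p) : ℚ_[p] :=
  x 0 ^ 2 - (a : ℚ_[p]) * x 1 ^ 2 - (p : ℚ_[p]) * x 2 ^ 2 + (a : ℚ_[p]) * (p : ℚ_[p]) * x 3 ^ 2

/-- The dual elliptic quadratic form `f°(ξ) = a p ξ₁² − p ξ₂² − a ξ₃² + ξ₄²`. -/
def qfc (a : ℤ) (x : V p) : ℚ_[p] :=
  (a : ℚ_[p]) * (p : ℚ_[p]) * x 0 ^ 2 - (p : ℚ_[p]) * x 1 ^ 2 - (a : ℚ_[p]) * x 2 ^ 2 + x 3 ^ 2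

/-- `χ` is the standard additive character `χ(y) = exp(2πi {y}_p)` of `ℚ_p`, characterized as
the unique continuous function with `χ(m/pⁿ) = exp(2πi m/pⁿ)`. -/
def IsStdChar (χ : ℚ_[p] → ℂ) : Prop :=
  Continuous χ ∧ ∀ (m : ℤ) (n : ℕ),
    χ ((m : ℚ_[p]) / (p : ℚ_[p]) ^ n) =
      Complex.exp (2 * (Real.pi : ℂ) * Complex.I * (m : ℂ) / (p : ℂ) ^ n)

/-- The pseudodifferential operator
`(f(∂,γ)φ)(x) = ((1 − p^γ)/(1 − p^{−γ−2})) ∫ (φ(x−y) − φ(x)) |f(y)|_p^{−γ−2} d⁴y`. -/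
def fop (μ : Measure (V p)) (a : ℤ) (γ : ℝ) (φ : V p → ℂ) (x : V p) : ℂ :=
  (((1 - (p : ℝ) ^ γ) / (1 - (p : ℝ) ^ (-γ - 2)) : ℝ) : ℂ) *
    ∫ y, (φ (x - y) - φ x) * ((‖qf p a y‖ ^ (-γ - 2) : ℝ) : ℂ) ∂μ

/-- Membership in the domain of `f(∂,γ)`: `φ` is locally constant and
`∫_{‖x‖_p ≥ p^m} |φ(x)| |f(x)|_p^{−γ−2} d⁴x < ∞` for some `m ∈ ℤ`. -/
def InDomain (μ : Measure (V p)) (a : ℤ) (γ : ℝ) (φ : V p → ℂ) : Prop :=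
  IsLocallyConstant φ ∧ ∃ m : ℤ,
    IntegrableOn (fun x => ‖φ x‖ * ‖qf p a x‖ ^ (-γ - 2)) {x : V p | (p : ℝ) ^ m ≤ ‖x‖} μ

/-- The space `𝔐_λ` of locally constant functions `φ : ℚ_p⁴ → ℂ` with
`|φ(x)| ≤ C (1 + ‖x‖_p^λ)` for some constant `C`. -/
def Mlam (lam : ℝ) (φ : V p → ℂ) : Prop :=
  IsLocallyConstant φ ∧ ∃ C : ℝ, ∀ x : V p, ‖φ x‖ ≤ C * (1 + ‖x‖ ^ lam)

lemma sq_le_norm_sq_sub_mul_sq {a : ℤ} (ha : IsQNR p a) (s t : ℚ_[p]) :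
    max ‖s‖ ‖t‖ ^ 2 ≤ ‖s ^ 2 - (a : ℚ_[p]) * t ^ 2‖ := by
  have ha1 : ‖(a : ℚ_[p])‖ ≤ 1 := Padic.norm_int_le_one a
  have ht : ‖t‖ ^ 2 ≤ ‖s ^ 2 - (a : ℚ_[p]) * t ^ 2‖ := by
    by_contra! h
    have ht0 : t ≠ 0 := by
      rintro rfl
      exact absurd h (by simp)
    have htn : 0 < ‖t‖ := norm_pos_iff.2 ht0
    set r : ℚ_[p] := s / t with hr
    have hra : ‖r ^ 2 - (a : ℚ_[p])‖ < 1 := by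
      have : r ^ 2 - (a : ℚ_[p]) = (s ^ 2 - (a : ℚ_[p]) * t ^ 2) / t ^ 2 := by
        rw [hr]; field_simp
      rw [this, norm_div, norm_pow, div_lt_one (by positivity)]
      exact h
    have hr1 : ‖r‖ ≤ 1 := by
      have h1 : ‖r ^ 2‖ ≤ 1 := by
        have h2 := IsUltrametricDist.norm_add_le_max (r ^ 2 - (a : ℚ_[p])) (a : ℚ_[p])
        rw [sub_add_cancel] at h2
        exact h2.trans (max_le hra.le ha1)
      rw [norm_pow] at h1
      exact (pow_le_one_iff_of_nonneg (norm_nonneg _) two_ne_zero).1 h1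
    let ρ : ℤ_[p] := ⟨r, hr1⟩
    have hρ : ‖ρ ^ 2 - (a : ℤ_[p])‖ < 1 := by
      rw [PadicInt.norm_def]
      push_cast
      exact hra
    have hmem : ρ ^ 2 - (a : ℤ_[p]) ∈ RingHom.ker (PadicInt.toZMod (p := p)) := by
      rw [PadicInt.ker_toZMod, IsLocalRing.mem_maximalIdeal, PadicInt.mem_nonunits]
      exact hρ
    rw [RingHom.mem_ker, map_sub, map_pow, map_intCast, sub_eq_zero] at hmem
    exact ha _ hmem
  have hs : ‖s‖ ^ 2 ≤ ‖s ^ 2 - (a : ℚ_[p]) * t ^ 2‖ := by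
    have h2 := IsUltrametricDist.norm_add_le_max (s ^ 2 - (a : ℚ_[p]) * t ^ 2)
      ((a : ℚ_[p]) * t ^ 2)
    rw [sub_add_cancel, norm_pow] at h2
    refine h2.trans (max_le le_rfl ?_)
    rw [norm_mul, norm_pow]
    exact (mul_le_of_le_one_left (by positivity) ha1).trans ht
  rcases le_total ‖s‖ ‖t‖ with h | h
  · rwa [max_eq_right h]
  · rwa [max_eq_left h]

lemma norm_sq_sub_mul_sq {a : ℤ} (ha : IsQNR p a) (s t : ℚ_[p]) :
    ‖s ^ 2 - (a : ℚ_[p]) * t ^ 2‖ = max ‖s‖ ‖t‖ ^ 2 := by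
  refine le_antisymm ?_ (sq_le_norm_sq_sub_mul_sq p ha s t)
  have ha1 : ‖(a : ℚ_[p])‖ ≤ 1 := Padic.norm_int_le_one a
  have h := IsUltrametricDist.norm_add_le_max (s ^ 2) (-((a : ℚ_[p]) * t ^ 2))
  rw [← sub_eq_add_neg, norm_neg, norm_mul, norm_pow, norm_pow] at h
  refine h.trans (max_le ?_ ((mul_le_of_le_one_left (by positivity) ha1).trans ?_))
  · gcongr; exact le_max_left _ _
  · gcongr; exact le_max_right _ _

lemma mul_norm_le_of_norm_lt {s t : ℚ_[p]} (h : ‖s‖ < ‖t‖) : (p : ℝ) * ‖s‖ ≤ ‖t‖ := by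
  have ht : t ≠ 0 := norm_pos_iff.1 ((norm_nonneg s).trans_lt h)
  have hp0 : (0 : ℝ) < p := by exact_mod_cast (Fact.out : p.Prime).pos
  have h1 : ‖s‖ < (p : ℝ) ^ (-t.valuation - 1 + 1) := by
    rw [sub_add_cancel, ← Padic.norm_eq_zpow_neg_valuation ht]; exact h
  rw [← Padic.norm_le_pow_iff_norm_lt_pow_add_one, zpow_sub_one₀ hp0.ne',
    ← Padic.norm_eq_zpow_neg_valuation ht, ← div_eq_mul_inv, le_div_iff₀ hp0] at h1
  linarith

lemma exists_norm_eq_max (s t : ℚ_[p]) : ∃ z : ℚ_[p], ‖z‖ = max ‖s‖ ‖t‖ := by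
  rcases max_choice ‖s‖ ‖t‖ with h | h
  exacts [⟨s, h.symm⟩, ⟨t, h.symm⟩]

/-- Ellipticity of the quadratic form. -/
lemma norm_sq_le_mul_norm_qf {a : ℤ} (ha : IsQNR p a) (x : V p) :
    ‖x‖ ^ 2 ≤ p * ‖qf p a x‖ := by
  have hp1 : (1 : ℝ) < p := by exact_mod_cast (Fact.out : p.Prime).one_lt
  have hp0 : (0 : ℝ) < p := by linarith
  obtain ⟨z, hz⟩ := exists_norm_eq_max p (x 0) (x 1)
  obtain ⟨w, hw⟩ := exists_norm_eq_max p (x 2) (x 3)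
  set X : ℚ_[p] := x 0 ^ 2 - (a : ℚ_[p]) * x 1 ^ 2 with hX
  set Y : ℚ_[p] := (p : ℚ_[p]) * (x 2 ^ 2 - (a : ℚ_[p]) * x 3 ^ 2) with hY
  have hXn : ‖X‖ = ‖z‖ ^ 2 := by rw [hX, norm_sq_sub_mul_sq p ha, hz]
  have hYn : p * ‖Y‖ = ‖w‖ ^ 2 := by
    rw [hY, norm_mul, norm_sq_sub_mul_sq p ha, hw, Padic.norm_p]
    field_simp
  have hq : qf p a x = X + -Y := by rw [hX, hY, qf]; ring
  have hxn : ‖x‖ ≤ max ‖z‖ ‖w‖ := by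
    rw [pi_norm_le_iff_of_nonneg (by positivity), hz, hw]
    intro i
    fin_cases i <;> simp
  rcases le_or_gt ‖w‖ ‖z‖ with h | h
  · have hx : ‖x‖ ^ 2 ≤ ‖z‖ ^ 2 := by
      rw [max_eq_left h] at hxn
      gcongr
    rcases (norm_nonneg z).eq_or_lt with h0 | h0
    · rw [← h0] at hx
      exact hx.trans (by simpa using by positivity)
    have hlt : ‖-Y‖ < ‖X‖ := by
      rw [norm_neg, hXn]
      have : ‖w‖ ^ 2 ≤ ‖z‖ ^ 2 := by gcongr
      nlinarith [pow_pos h0 2]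
    rw [hq, IsUltrametricDist.norm_add_eq_max_of_norm_ne_norm hlt.ne', max_eq_left hlt.le, hXn]
    nlinarith [pow_pos h0 2]
  · have hx : ‖x‖ ^ 2 ≤ ‖w‖ ^ 2 := by
      rw [max_eq_right h.le] at hxn
      gcongr
    have h0 : 0 < ‖w‖ := (norm_nonneg z).trans_lt h
    have hlt : ‖X‖ < ‖-Y‖ := by
      rw [norm_neg, hXn]
      have h1 := mul_norm_le_of_norm_lt p h
      have h2 : (p * ‖z‖) ^ 2 ≤ ‖w‖ ^ 2 := by gcongr
      have h3 : p * (p * ‖z‖ ^ 2) ≤ p * ‖Y‖ := by rw [hYn]; linarith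
      have h4 := le_of_mul_le_mul_left h3 hp0
      rcases (norm_nonneg z).eq_or_lt with hz0 | hz0
      · rw [← hz0]
        have : 0 < p * ‖Y‖ := by rw [hYn]; positivity
        simpa using pos_of_mul_pos_right this hp0.le
      · nlinarith [pow_pos hz0 2]
    rw [hq, IsUltrametricDist.norm_add_eq_max_of_norm_ne_norm hlt.ne, max_eq_right hlt.le,
      norm_neg, hYn]
    exact hx

lemma measureReal_closedBall_le (μ : Measure (V p)) [μ.IsAddHaarMeasure] (m : ℤ) :
    μ.real (Metric.closedBall 0 ((p : ℝ) ^ (m + 1))) ≤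
      (p : ℝ) ^ 4 * μ.real (Metric.closedBall 0 ((p : ℝ) ^ m)) := by
  have hp0 : (p : ℝ) ≠ 0 := by exact_mod_cast (Fact.out : p.Prime).ne_zero
  have hp0' : (p : ℚ_[p]) ≠ 0 := by exact_mod_cast (Fact.out : p.Prime).ne_zero
  let c : (Fin 4 → Fin p) → V p := fun k i => (p : ℚ_[p]) ^ (-(m + 1)) * ((k i : ℕ) : ℚ_[p])
  have hcover : Metric.closedBall (0 : V p) ((p : ℝ) ^ (m + 1)) ⊆
      ⋃ k, Metric.closedBall (c k) ((p : ℝ) ^ m) := by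
    intro y hy
    rw [mem_closedBall_zero_iff, pi_norm_le_iff_of_nonneg (by positivity)] at hy
    have key : ∀ i, ∃ k : Fin p,
        ‖y i - (p : ℚ_[p]) ^ (-(m + 1)) * ((k : ℕ) : ℚ_[p])‖ ≤ (p : ℝ) ^ m := by
      intro i
      have h1 : ‖(p : ℚ_[p]) ^ (m + 1) * y i‖ ≤ 1 := by
        rw [norm_mul, Padic.norm_p_zpow, zpow_neg]
        exact inv_mul_le_one_of_le₀ (hy i) (by positivity)
      obtain ⟨n, hn, hmem⟩ := PadicInt.exists_mem_range
        (⟨(p : ℚ_[p]) ^ (m + 1) * y i, h1⟩ : ℤ_[p])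
      refine ⟨⟨n, hn⟩, ?_⟩
      rw [IsLocalRing.mem_maximalIdeal, PadicInt.mem_nonunits, PadicInt.norm_def] at hmem
      rw [Padic.norm_le_pow_iff_norm_lt_pow_add_one]
      have : y i - (p : ℚ_[p]) ^ (-(m + 1)) * (n : ℚ_[p]) =
          (p : ℚ_[p]) ^ (-(m + 1)) * ((p : ℚ_[p]) ^ (m + 1) * y i - n) := by
        rw [mul_sub, ← mul_assoc, ← zpow_add₀ hp0']
        simp
      rw [this, norm_mul, Padic.norm_p_zpow, neg_neg]
      exact mul_lt_of_lt_one_right (by positivity) hmem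
    choose k hk using key
    refine mem_iUnion.2 ⟨k, ?_⟩
    rw [mem_closedBall_iff_norm, pi_norm_le_iff_of_nonneg (by positivity)]
    exact hk
  calc μ.real (Metric.closedBall 0 ((p : ℝ) ^ (m + 1)))
      ≤ μ.real (⋃ k, Metric.closedBall (c k) ((p : ℝ) ^ m)) :=
        measureReal_mono hcover
          ((measure_iUnion_fintype_le _ _).trans_lt
            (ENNReal.sum_lt_top.2 fun _ _ => measure_closedBall_lt_top)).ne
    _ ≤ ∑ k, μ.real (Metric.closedBall (c k) ((p : ℝ) ^ m)) := measureReal_iUnion_fintype_le _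
    _ = (p : ℝ) ^ 4 * μ.real (Metric.closedBall 0 ((p : ℝ) ^ m)) := by
        simp [measureReal_def, Measure.addHaar_closedBall_center μ (c _)]

lemma measureReal_closedBall_add_le (μ : Measure (V p)) [μ.IsAddHaarMeasure] (m : ℤ) (j : ℕ) :
    μ.real (Metric.closedBall 0 ((p : ℝ) ^ (m + j))) ≤
      ((p : ℝ) ^ 4) ^ j * μ.real (Metric.closedBall 0 ((p : ℝ) ^ m)) := by
  induction j with
  | zero => simp
  | succ j ih =>
    have h := measureReal_closedBall_le p μ (m + j)
    push_cast
    rw [← add_assoc, pow_succ' _ j, mul_assoc]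
    exact h.trans (by gcongr)

lemma integrableOn_norm_rpow (μ : Measure (V p)) [μ.IsAddHaarMeasure] {β : ℝ} (hβ : β < -4)
    (m : ℤ) : IntegrableOn (fun y : V p => ‖y‖ ^ β) {y | (p : ℝ) ^ m ≤ ‖y‖} μ := by
  have hp1 : (1 : ℝ) < p := by exact_mod_cast (Fact.out : p.Prime).one_lt
  have hp0 : (0 : ℝ) < p := by linarith
  have hmeas : Measurable fun y : V p => ‖y‖ ^ β := measurable_norm.pow_const β
  let S : ℕ → Set (V p) := fun j =>
    {y | (p : ℝ) ^ (m + j) ≤ ‖y‖} ∩ Metric.closedBall 0 ((p : ℝ) ^ (m + (j + 1 : ℕ)))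
  have hS : {y : V p | (p : ℝ) ^ m ≤ ‖y‖} ⊆ ⋃ j, S j := by
    intro y hy
    have hy0 : 0 < ‖y‖ := (zpow_pos hp0 m).trans_le hy
    obtain ⟨n, hn1, hn2⟩ := exists_mem_Ico_zpow hy0 hp1
    have hmn : m ≤ n := by
      have := (zpow_lt_zpow_iff_right₀ hp1).1 (lt_of_le_of_lt hy hn2)
      omega
    obtain ⟨j, rfl⟩ := Int.le.dest hmn
    refine mem_iUnion.2 ⟨j, hn1, ?_⟩
    rw [mem_closedBall_zero_iff]
    push_cast
    rw [← add_assoc]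
    exact hn2.le
  have hSm : ∀ j, MeasurableSet (S j) := fun j =>
    (measurableSet_le measurable_const measurable_norm).inter measurableSet_closedBall
  have hSfin : ∀ j, μ (S j) < ⊤ := fun j =>
    (measure_mono inter_subset_right).trans_lt measure_closedBall_lt_top
  have hbound : ∀ j, ∀ y ∈ S j, ‖‖‖y‖ ^ β‖‖ ≤ ((p : ℝ) ^ (m + j)) ^ β := by
    intro j y hy
    rw [norm_norm, Real.norm_of_nonneg (by positivity)]
    exact Real.rpow_le_rpow_of_nonpos (by positivity) hy.1 (by linarith)
  refine (integrableOn_iUnion_of_summable_integral_norm (fun j => ?_) ?_).mono_set hS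
  · exact Measure.integrableOn_of_bounded (M := ((p : ℝ) ^ (m + j)) ^ β) (hSfin j).ne
      hmeas.aestronglyMeasurable
      ((ae_restrict_iff' (hSm j)).2 (ae_of_all _ fun y hy => by simpa using hbound j y hy))
  · have hgeom : Summable fun j : ℕ => ((p : ℝ) ^ m) ^ β * (p : ℝ) ^ 4 *
        μ.real (Metric.closedBall 0 ((p : ℝ) ^ m)) * ((p : ℝ) ^ (β + 4)) ^ j :=
      (summable_geometric_of_lt_one (by positivity)
        (Real.rpow_lt_one_of_one_lt_of_neg hp1 (by linarith))).mul_left _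
    refine hgeom.of_nonneg_of_le (fun j => integral_nonneg fun _ => norm_nonneg _) fun j => ?_
    have h1 := norm_setIntegral_le_of_norm_le_const (hSfin j) (hbound j)
    rw [Real.norm_of_nonneg (integral_nonneg fun _ => norm_nonneg _)] at h1
    have h2 : μ.real (S j) ≤ _ := (measureReal_mono inter_subset_right
      measure_closedBall_lt_top.ne).trans (measureReal_closedBall_add_le p μ m (j + 1))
    refine h1.trans ((mul_le_mul_of_nonneg_left h2 (by positivity)).trans_eq ?_)
    have e1 : ((p : ℝ) ^ (m + j)) ^ β = ((p : ℝ) ^ m) ^ β * ((p : ℝ) ^ β) ^ j := by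
      rw [zpow_add₀ hp0.ne', Real.mul_rpow (by positivity) (by positivity), zpow_natCast,
        ← Real.rpow_natCast, ← Real.rpow_natCast, ← Real.rpow_mul hp0.le, ← Real.rpow_mul hp0.le,
        mul_comm (j : ℝ) β]
    have e2 : (p : ℝ) ^ (β + 4) = (p : ℝ) ^ β * (p : ℝ) ^ 4 := by
      rw [Real.rpow_add hp0]; norm_cast
    rw [e1, e2, mul_pow, pow_succ]
    ring

lemma continuous_qf (a : ℤ) : Continuous (qf p a) := by
  unfold qf
  fun_prop

lemma measurable_kernel (a : ℤ) (β : ℝ) : Measurable fun y : V p => ‖qf p a y‖ ^ β :=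
  (continuous_qf p a).norm.measurable.pow_const β

lemma kernel_le {a : ℤ} (ha : IsQNR p a) {γ : ℝ} (hγ : 0 < γ) {y : V p} (hy : 0 < ‖y‖) :
    ‖qf p a y‖ ^ (-γ - 2) ≤ (p : ℝ) ^ (γ + 2) * ‖y‖ ^ (-2 * γ - 4) := by
  have hp0 : (0 : ℝ) < p := by exact_mod_cast (Fact.out : p.Prime).pos
  have h : ‖y‖ ^ 2 / p ≤ ‖qf p a y‖ := by
    rw [div_le_iff₀' hp0]; exact norm_sq_le_mul_norm_qf p ha y
  calc ‖qf p a y‖ ^ (-γ - 2) ≤ (‖y‖ ^ 2 / p) ^ (-γ - 2) :=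
        Real.rpow_le_rpow_of_nonpos (by positivity) h (by linarith)
    _ = (p : ℝ) ^ (γ + 2) * ‖y‖ ^ (-2 * γ - 4) := by
        rw [Real.div_rpow (by positivity) hp0.le, ← Real.rpow_natCast, ← Real.rpow_mul hy.le,
          show -γ - 2 = -(γ + 2) by ring, Real.rpow_neg hp0.le, div_inv_eq_mul, mul_comm]
        congr 2
        push_cast
        ring

/-- The tail weight `‖y‖ ^ β |f(y)|_p ^ (-γ - 2)`, cut off to the region `‖y‖ ≥ p ^ m`. -/
def tail (a : ℤ) (γ β : ℝ) (m : ℤ) (y : V p) : ℝ :=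
  {y : V p | (p : ℝ) ^ m ≤ ‖y‖}.indicator (fun y => ‖y‖ ^ β * ‖qf p a y‖ ^ (-γ - 2)) y

lemma measurableSet_le_norm (r : ℝ) : MeasurableSet {y : V p | r ≤ ‖y‖} :=
  measurableSet_le measurable_const measurable_norm

lemma integrable_tail (μ : Measure (V p)) [μ.IsAddHaarMeasure] {a : ℤ} (ha : IsQNR p a)
    {γ β : ℝ} (hγ : 0 < γ) (hβ : β < 2 * γ) (m : ℤ) : Integrable (tail p a γ β m) μ := by
  have hp0 : (0 : ℝ) < p := by exact_mod_cast (Fact.out : p.Prime).pos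
  have hS := measurableSet_le_norm p ((p : ℝ) ^ m)
  refine (integrable_indicator_iff hS).2 ?_
  refine ((integrableOn_norm_rpow p μ (β := β - 2 * γ - 4) (by linarith) m).const_mul
    ((p : ℝ) ^ (γ + 2))).mono'
    ((measurable_norm.pow_const β).mul (measurable_kernel p a _)).aestronglyMeasurable ?_
  refine (ae_restrict_iff' hS).2 (ae_of_all _ fun y hy => ?_)
  have hy0 : 0 < ‖y‖ := (zpow_pos hp0 m).trans_le hy
  rw [Real.norm_of_nonneg (by positivity)]
  calc ‖y‖ ^ β * ‖qf p a y‖ ^ (-γ - 2)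
      ≤ ‖y‖ ^ β * ((p : ℝ) ^ (γ + 2) * ‖y‖ ^ (-2 * γ - 4)) := by
        gcongr; exact kernel_le p ha hγ hy0
    _ = (p : ℝ) ^ (γ + 2) * ‖y‖ ^ (β - 2 * γ - 4) := by
        rw [show β - 2 * γ - 4 = β + (-2 * γ - 4) by ring, Real.rpow_add hy0]; ring

/-- A function on `V p` which is continuous, uniformly locally constant and `O(1 + ‖x‖ ^ (2 * lam))`
has an integrable difference kernel. -/
lemma integrable_sub_mul_kernel (μ : Measure (V p)) [μ.IsAddHaarMeasure] {a : ℤ} (ha : IsQNR p a)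
    {γ lam : ℝ} (hlam0 : 0 ≤ lam) (hγ : lam < γ) {φ : V p → ℂ} (hφ : Continuous φ)
    {C δ : ℝ} (hδ : 0 < δ) (hC : ∀ x, ‖φ x‖ ≤ C * (1 + ‖x‖ ^ (2 * lam)))
    (hconst : ∀ x y : V p, ‖x - y‖ ≤ δ → φ x = φ y) (x : V p) :
    Integrable (fun y => (φ (x - y) - φ x) * ((‖qf p a y‖ ^ (-γ - 2) : ℝ) : ℂ)) μ := by
  have hp1 : (1 : ℝ) < p := by exact_mod_cast (Fact.out : p.Prime).one_lt
  have hp0 : (0 : ℝ) < p := by linarith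
  have hC0 : 0 ≤ C := by
    refine nonneg_of_mul_nonneg_left ((norm_nonneg _).trans (hC 0)) (by positivity)
  obtain ⟨N, hN⟩ := exists_pow_lt_of_lt_one hδ (inv_lt_one_of_one_lt₀ hp1)
  have hN' : (p : ℝ) ^ (-(N : ℤ)) ≤ δ := by
    rw [zpow_neg, zpow_natCast, ← inv_pow]; exact hN.le
  set D : ℝ := C * (1 + ‖x‖ ^ (2 * lam)) + C * (1 + ‖x‖ ^ (2 * lam)) with hD
  have hint := ((integrable_tail p μ ha (γ := γ) (β := 0) (by linarith) (by linarith)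
    (-(N : ℤ))).const_mul D).add ((integrable_tail p μ ha (γ := γ) (β := 2 * lam) (by linarith)
    (by linarith) (-(N : ℤ))).const_mul C)
  refine hint.mono' ?_ (ae_of_all _ fun y => ?_)
  · refine Measurable.aestronglyMeasurable ?_
    exact (((hφ.comp (continuous_const.sub continuous_id)).sub continuous_const).measurable).mul
      (Complex.measurable_ofReal.comp (measurable_kernel p a _))
  · simp only [Pi.add_apply, tail]
    by_cases hy : (p : ℝ) ^ (-(N : ℤ)) ≤ ‖y‖
    · rw [indicator_of_mem (by exact hy), indicator_of_mem (by exact hy), norm_mul,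
        Complex.norm_real, Real.norm_of_nonneg (by positivity), Real.rpow_zero, one_mul,
        ← mul_assoc, ← add_mul]
      gcongr
      have h1 : ‖x - y‖ ^ (2 * lam) ≤ ‖x‖ ^ (2 * lam) + ‖y‖ ^ (2 * lam) := by
        have h2 : ‖x - y‖ ≤ max ‖x‖ ‖y‖ := by
          simpa [sub_eq_add_neg] using IsUltrametricDist.norm_add_le_max x (-y)
        rcases le_max_iff.1 h2 with h | h
        · exact (Real.rpow_le_rpow (norm_nonneg _) h (by linarith)).trans
            (le_add_of_nonneg_right (by positivity))
        · exact (Real.rpow_le_rpow (norm_nonneg _) h (by linarith)).trans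
            (le_add_of_nonneg_left (by positivity))
      calc ‖φ (x - y) - φ x‖ ≤ ‖φ (x - y)‖ + ‖φ x‖ := norm_sub_le _ _
        _ ≤ C * (1 + ‖x - y‖ ^ (2 * lam)) + C * (1 + ‖x‖ ^ (2 * lam)) :=
            add_le_add (hC _) (hC _)
        _ ≤ C * (1 + (‖x‖ ^ (2 * lam) + ‖y‖ ^ (2 * lam))) + C * (1 + ‖x‖ ^ (2 * lam)) := by
            gcongr
        _ = D + C * ‖y‖ ^ (2 * lam) := by rw [hD]; ring
    · have h0 : φ (x - y) = φ x := hconst _ _ (by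
        simpa using (not_le.1 hy).le.trans hN')
      rw [h0, indicator_of_notMem (by exact hy), indicator_of_notMem (by exact hy)]
      simp

/-- The barrier function `max(1, ‖x‖) ^ β`. -/
def barrier (β : ℝ) (x : V p) : ℝ := max 1 ‖x‖ ^ β

lemma one_le_barrier {β : ℝ} (hβ : 0 ≤ β) (x : V p) : 1 ≤ barrier p β x :=
  Real.one_le_rpow (le_max_left _ _) hβ

lemma barrier_sub_mul_kernel_le (a : ℤ) (γ : ℝ) {β : ℝ} (hβ : 0 ≤ β) (x y : V p) :
    (barrier p β (x - y) - barrier p β x) * ‖qf p a y‖ ^ (-γ - 2) ≤ tail p a γ β 0 y := by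
  have h2 : ‖x - y‖ ≤ max ‖x‖ ‖y‖ := by
    simpa [sub_eq_add_neg] using IsUltrametricDist.norm_add_le_max x (-y)
  have hk : 0 ≤ ‖qf p a y‖ ^ (-γ - 2) := by positivity
  have hb : 0 ≤ barrier p β x := by unfold barrier; positivity
  unfold tail
  by_cases hy : max 1 ‖x‖ ≤ ‖y‖
  · rw [indicator_of_mem (by simpa using (le_max_left _ _).trans hy)]
    gcongr
    refine (sub_le_self _ hb).trans (Real.rpow_le_rpow (by positivity) ?_ hβ)
    exact max_le ((le_max_left _ _).trans hy) (h2.trans (max_le ((le_max_right _ _).trans hy) le_rfl))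
  · have hle : barrier p β (x - y) ≤ barrier p β x := by
      refine Real.rpow_le_rpow (by positivity) (max_le (le_max_left _ _) ?_) hβ
      exact h2.trans (max_le (le_max_right _ _) (not_le.1 hy).le)
    refine (mul_nonpos_of_nonpos_of_nonneg (sub_nonpos.2 hle) hk).trans ?_
    exact indicator_nonneg (fun _ _ => by positivity) _

lemma fop_const_nonpos {γ : ℝ} (hγ : 0 < γ) :
    (1 - (p : ℝ) ^ γ) / (1 - (p : ℝ) ^ (-γ - 2)) ≤ 0 := by
  have hp1 : (1 : ℝ) < p := by exact_mod_cast (Fact.out : p.Prime).one_lt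
  refine div_nonpos_of_nonpos_of_nonneg ?_ ?_
  · linarith [Real.one_le_rpow hp1.le hγ.le]
  · linarith [Real.rpow_le_one_of_one_le_of_nonpos hp1.le (z := -γ - 2) (by linarith)]

/-- Nonlocal maximum principle: at a global maximum of `Re (c φ) - ε · barrier`, the operator
applied to `Re (c φ)` is bounded below by `-ε K`. -/
lemma exists_neg_mul_le_re_fop (μ : Measure (V p)) [μ.IsAddHaarMeasure] {a : ℤ}
    (ha : IsQNR p a) {γ lam β : ℝ} (hlam0 : 0 ≤ lam) (hγ : lam < γ) (hβ0 : 0 ≤ β)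
    (hβ : β < 2 * γ) :
    ∃ K : ℝ, 0 ≤ K ∧ ∀ {φ : V p → ℂ} {C δ : ℝ}, Continuous φ → 0 < δ →
      (∀ x, ‖φ x‖ ≤ C * (1 + ‖x‖ ^ (2 * lam))) →
      (∀ x y : V p, ‖x - y‖ ≤ δ → φ x = φ y) →
      ∀ (c : ℂ) (ε : ℝ) (x : V p), 0 ≤ ε →
      (∀ y, (c * φ y).re - ε * barrier p β y ≤ (c * φ x).re - ε * barrier p β x) →
      -(ε * K) ≤ (c * fop p μ a γ φ x).re := by
  have hγ0 : 0 < γ := hlam0.trans_lt hγ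
  set κ : ℝ := (1 - (p : ℝ) ^ γ) / (1 - (p : ℝ) ^ (-γ - 2)) with hκ
  have hκ0 : κ ≤ 0 := fop_const_nonpos p hγ0
  have hI0 : 0 ≤ ∫ y, tail p a γ β 0 y ∂μ :=
    integral_nonneg fun y => indicator_nonneg (fun _ _ => by positivity) _
  refine ⟨-κ * ∫ y, tail p a γ β 0 y ∂μ, mul_nonneg (neg_nonneg.2 hκ0) hI0, ?_⟩
  intro φ C δ hφ hδ hC hconst c ε x hε hmax
  have hint := (integrable_sub_mul_kernel p μ ha hlam0 hγ hφ hδ hC hconst x).const_mul c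
  have hre : (c * fop p μ a γ φ x).re = κ * ∫ y,
      (c * ((φ (x - y) - φ x) * ((‖qf p a y‖ ^ (-γ - 2) : ℝ) : ℂ))).re ∂μ := by
    have h := integral_re (𝕜 := ℂ) hint
    simp only [RCLike.re_to_complex] at h
    rw [h, integral_const_mul, fop, mul_left_comm, Complex.re_ofReal_mul]
  have hle : ∫ y, (c * ((φ (x - y) - φ x) * ((‖qf p a y‖ ^ (-γ - 2) : ℝ) : ℂ))).re ∂μ ≤
      ∫ y, ε * tail p a γ β 0 y ∂μ := by
    refine integral_mono hint.re ((integrable_tail p μ ha hγ0 hβ 0).const_mul ε) fun y => ?_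
    have hk : 0 ≤ ‖qf p a y‖ ^ (-γ - 2) := by positivity
    have h1 := hmax (x - y)
    have h2 := mul_le_mul_of_nonneg_left (barrier_sub_mul_kernel_le p a γ hβ0 x y) hε
    have h3 : (c * (φ (x - y) - φ x)).re ≤ ε * (barrier p β (x - y) - barrier p β x) := by
      rw [mul_sub, Complex.sub_re]; linarith
    have h4 := mul_le_mul_of_nonneg_right h3 hk
    simp only
    rw [← mul_assoc, Complex.re_mul_ofReal]
    linarith
  rw [integral_const_mul] at hle
  rw [hre]
  nlinarith [mul_le_mul_of_nonpos_left hle hκ0]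

lemma exists_lt_barrier {lam lam' : ℝ} (hlam : 0 ≤ lam) (h : lam < lam') (C : ℝ) {ε : ℝ}
    (hε : 0 < ε) :
    ∃ R : ℝ, ∀ x : V p, R ≤ ‖x‖ → C * (1 + ‖x‖ ^ (2 * lam)) < ε * barrier p (2 * lam') x := by
  have ht : Tendsto (fun s : ℝ => s ^ (2 * lam' - 2 * lam)) atTop atTop :=
    tendsto_rpow_atTop (by linarith)
  obtain ⟨R, hR⟩ := eventually_atTop.1 ((ht.eventually_gt_atTop (2 * |C| / ε)).and
    (eventually_ge_atTop 1))
  refine ⟨R, fun x hx => ?_⟩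
  obtain ⟨h1, h2⟩ := hR _ hx
  have h0 : 0 < ‖x‖ := by linarith
  rw [barrier, max_eq_right h2, show 2 * lam' = (2 * lam' - 2 * lam) + 2 * lam by ring,
    Real.rpow_add h0]
  have h3 : 1 ≤ ‖x‖ ^ (2 * lam) := Real.one_le_rpow h2 (by linarith)
  rw [div_lt_iff₀ hε] at h1
  have h4 := mul_lt_mul_of_pos_right h1 (zero_lt_one.trans_le h3)
  have h5 : C * (1 + ‖x‖ ^ (2 * lam)) ≤ |C| * (1 + ‖x‖ ^ (2 * lam)) := by
    gcongr; exact le_abs_self C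
  nlinarith [abs_nonneg C]

lemma nonneg_of_hasDerivAt_of_forall_le {g : ℝ → ℝ} {g' s t : ℝ} (h : HasDerivAt g g' t)
    (hst : s < t) (hmax : ∀ r ∈ Ioo s t, g r ≤ g t) : 0 ≤ g' := by
  have h1 := h.tendsto_slope.mono_left (nhdsWithin_mono t (fun r (hr : r ∈ Iio t) => ne_of_lt hr))
  refine ge_of_tendsto h1 ?_
  filter_upwards [Ioo_mem_nhdsLT hst] with r hr
  rw [slope_def_field]
  exact div_nonneg_of_nonpos (sub_nonpos.2 (hmax r hr)) (sub_nonpos.2 hr.2.le)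

/-- uniqueness for the homogeneous Cauchy problem with variable
coefficients: a solution `u ∈ 𝔐_{2λ}` (uniformly in `t`) of
`∂u/∂t + a₀ f(∂,α)u + Σ a_k f(∂,α_k)u + b u = 0` with `u(x,0) = 0` vanishes identically. -/
theorem statement19
    (hp : p ≠ 2) (a : ℤ) (ha : IsQNR p a)
    (μ : Measure (V p)) [μ.IsAddHaarMeasure] (hμ : μ {x : V p | ‖x‖ ≤ 1} = 1)
    (n : ℕ) (α T lam : ℝ) (αs : Fin n → ℝ)
    (hα : 1 < α) (hαs0 : ∀ k, 0 < αs k) (hαsmono : StrictMono αs) (hαsα : ∀ k, αs k < α)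
    (hT : 0 < T) (hlam0 : 0 ≤ lam) (hlamα : lam < α)
    (A0 : V p → ℝ → ℝ) (A : Fin n → V p → ℝ → ℝ) (B : V p → ℝ → ℝ)
    (hlam : (∀ (k : Fin n) (x : V p) (t : ℝ), A k x t = 0) ∨ ∀ k : Fin n, lam < αs k)
    (hA0pos : ∀ (x : V p), ∀ t ∈ Icc (0 : ℝ) T, 0 ≤ A0 x t)
    (hApos : ∀ (k : Fin n) (x : V p), ∀ t ∈ Icc (0 : ℝ) T, 0 ≤ A k x t)
    (hA0b : ∃ C : ℝ, ∀ (x : V p), ∀ t ∈ Icc (0 : ℝ) T, |A0 x t| ≤ C)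
    (hAb : ∀ k : Fin n, ∃ C : ℝ, ∀ (x : V p), ∀ t ∈ Icc (0 : ℝ) T, |A k x t| ≤ C)
    (hBb : ∃ C : ℝ, ∀ (x : V p), ∀ t ∈ Icc (0 : ℝ) T, |B x t| ≤ C)
    (hA0c : ContinuousOn (fun q : V p × ℝ => A0 q.1 q.2) (univ ×ˢ Icc 0 T))
    (hAc : ∀ k : Fin n, ContinuousOn (fun q : V p × ℝ => A k q.1 q.2) (univ ×ˢ Icc 0 T))
    (hBc : ContinuousOn (fun q : V p × ℝ => B q.1 q.2) (univ ×ˢ Icc 0 T))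
    (u : V p → ℝ → ℂ)
    (hucont : ContinuousOn (fun q : V p × ℝ => u q.1 q.2) (univ ×ˢ Icc 0 T))
    (hudom : ∀ t ∈ Icc (0 : ℝ) T, InDomain p μ a α (fun x => u x t) ∧
      ∀ k : Fin n, InDomain p μ a (αs k) (fun x => u x t))
    (hudiff : ∀ x : V p, ∀ t ∈ Ioc (0 : ℝ) T, DifferentiableAt ℝ (u x) t)
    (hudc : ∀ x : V p, ContinuousOn (deriv (u x)) (Ioc (0 : ℝ) T))
    (huM : ∃ C δ : ℝ, 0 < δ ∧ ∀ t ∈ Icc (0 : ℝ) T,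
      (∀ x : V p, ‖u x t‖ ≤ C * (1 + ‖x‖ ^ (2 * lam))) ∧
      (∀ x y : V p, ‖x - y‖ ≤ δ → u x t = u y t))
    (hueq : ∀ x : V p, ∀ t ∈ Ioc (0 : ℝ) T,
      deriv (u x) t + (A0 x t : ℂ) * fop p μ a α (fun y => u y t) x +
        (∑ k : Fin n, (A k x t : ℂ) * fop p μ a (αs k) (fun y => u y t) x) +
        (B x t : ℂ) * u x t = 0)
    (hu0 : ∀ x : V p, u x 0 = 0) :
    ∀ x : V p, ∀ t ∈ Icc (0 : ℝ) T, u x t = 0 := by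
  obtain ⟨C, δ, hδ, huCδ⟩ := huM
  obtain ⟨bA0, hbA0⟩ := hA0b
  choose bA hbA using hAb
  obtain ⟨bB, hbB⟩ := hBb
  have hT0 : (0 : ℝ) ∈ Icc (0 : ℝ) T := left_mem_Icc.2 hT.le
  obtain ⟨lam', hll, hlα, hlk⟩ : ∃ lam', lam < lam' ∧ lam' < α ∧
      ∀ k, (∀ x t, A k x t = 0) ∨ (lam < αs k ∧ lam' < αs k) := by
    have h1 : ∀ᶠ l in nhdsWithin lam (Ioi lam), lam < l := self_mem_nhdsWithin
    have h2 : ∀ᶠ l in nhdsWithin lam (Ioi lam), l < α := nhdsWithin_le_nhds (eventually_lt_nhds hlamα)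
    have h3 : ∀ᶠ l in nhdsWithin lam (Ioi lam), ∀ k, (∀ x t, A k x t = 0) ∨ (lam < αs k ∧ l < αs k) := by
      refine eventually_all.2 fun k => ?_
      rcases hlam with h | h
      · exact Eventually.of_forall fun _ => Or.inl (h k)
      · filter_upwards [nhdsWithin_le_nhds (eventually_lt_nhds (h k))] with l hl
        exact Or.inr ⟨h k, hl⟩
    exact (h1.and (h2.and h3)).exists
  have hβ0 : 0 ≤ 2 * lam' := by linarith
  obtain ⟨K0, hK0, hK0'⟩ := exists_neg_mul_le_re_fop p μ ha hlam0 hlamα hβ0 (by linarith)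
  have hK : ∀ k, ∃ K : ℝ, 0 ≤ K ∧ ∀ {t : ℝ}, t ∈ Icc (0 : ℝ) T →
      ∀ (c : ℂ) (ε : ℝ) (x : V p), 0 ≤ ε →
      (∀ y, (c * u y t).re - ε * barrier p (2 * lam') y ≤
        (c * u x t).re - ε * barrier p (2 * lam') x) →
      -(ε * (bA k * K)) ≤ A k x t * (c * fop p μ a (αs k) (fun y => u y t) x).re := by
    intro k
    have hbk : 0 ≤ bA k := (abs_nonneg _).trans (hbA k 0 0 hT0)
    rcases hlk k with h | ⟨h, h'⟩
    · refine ⟨0, le_rfl, fun _ c ε x _ _ => ?_⟩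
      simp [h]
    · obtain ⟨K, hK, hK'⟩ := exists_neg_mul_le_re_fop p μ ha hlam0 h hβ0 (by linarith)
      refine ⟨K, hK, fun {t} ht c ε x hε hmax => ?_⟩
      have h1 := hK' (hudom t ht).1.1.continuous hδ (huCδ t ht).1 (huCδ t ht).2 c ε x hε hmax
      have h2 := mul_le_mul_of_nonneg_left h1 (hApos k x t ht)
      have h3 := mul_le_mul_of_nonneg_right ((le_abs_self _).trans (hbA k x t ht))
        (mul_nonneg hε hK)
      linarith
  choose K hKnn hK' using hK
  have hbA0' : 0 ≤ bA0 := (abs_nonneg _).trans (hbA0 0 0 hT0)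
  have hbB' : 0 ≤ bB := (abs_nonneg _).trans (hbB 0 0 hT0)
  have hbA' : ∀ k, 0 ≤ bA k := fun k => (abs_nonneg _).trans (hbA k 0 0 hT0)
  set S : ℝ := bA0 * K0 + ∑ k, bA k * K k with hS
  have hS0 : 0 ≤ S := add_nonneg (mul_nonneg hbA0' hK0)
    (Finset.sum_nonneg fun k _ => mul_nonneg (hbA' k) (hKnn k))
  set M : ℝ := bB + S + 1 with hM
  have hbound : ∀ (c : ℂ) (ε : ℝ), 0 < ε → ∀ x : V p, ∀ t ∈ Icc (0 : ℝ) T,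
      (((Real.exp (-M * t) : ℝ) : ℂ) * c * u x t).re - ε * barrier p (2 * lam') x ≤ 0 := by
    intro c ε hε
    by_contra! hcon
    obtain ⟨x₂, t₂, ht₂, hpos⟩ := hcon
    set z : V p × ℝ → ℝ := fun q =>
      (((Real.exp (-M * q.2) : ℝ) : ℂ) * c * u q.1 q.2).re - ε * barrier p (2 * lam') q.1 with hz
    obtain ⟨R, hR⟩ := exists_lt_barrier p hlam0 hll (‖c‖ * C) hε
    have hfar : ∀ x : V p, R ≤ ‖x‖ → ∀ t ∈ Icc (0 : ℝ) T, z (x, t) < 0 := by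
      intro x hx t ht
      have h1 : (((Real.exp (-M * t) : ℝ) : ℂ) * c * u x t).re ≤ ‖c‖ * ‖u x t‖ := by
        refine (Complex.re_le_norm _).trans ?_
        rw [norm_mul, norm_mul, Complex.norm_real, Real.norm_of_nonneg (Real.exp_pos _).le]
        gcongr
        refine mul_le_of_le_one_left (norm_nonneg _) (Real.exp_le_one_iff.2 ?_)
        nlinarith [ht.1]
      have h2 := mul_le_mul_of_nonneg_left ((huCδ t ht).1 x) (norm_nonneg c)
      have h3 := hR x hx
      simp only [hz]
      linarith
    have hcont : ContinuousOn z (Metric.closedBall 0 R ×ˢ Icc 0 T) := by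
      have hu' := hucont.mono (prod_mono_left (subset_univ (Metric.closedBall (0 : V p) R)))
      have hbar : Continuous fun q : V p × ℝ => barrier p (2 * lam') q.1 := by
        unfold barrier
        exact (continuous_const.max continuous_fst.norm).rpow_const fun _ => Or.inr hβ0
      refine ContinuousOn.sub ?_ (continuous_const.mul hbar).continuousOn
      refine Complex.continuous_re.comp_continuousOn (ContinuousOn.mul ?_ hu')
      exact Continuous.continuousOn (by fun_prop)
    have hx₂ : x₂ ∈ Metric.closedBall (0 : V p) R := by
      rw [mem_closedBall_zero_iff]
      by_contra! h
      exact absurd hpos (hfar x₂ h.le t₂ ht₂).le.not_gt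
    obtain ⟨⟨x₁, t₁⟩, ⟨-, ht₁⟩, hmax⟩ :=
      ((isCompact_closedBall (0 : V p) R).prod isCompact_Icc).exists_isMaxOn
        ⟨(x₂, t₂), hx₂, ht₂⟩ hcont
    have hz₁ : 0 < z (x₁, t₁) := hpos.trans_le (hmax (mk_mem_prod hx₂ ht₂))
    have hmax' : ∀ y, ∀ t ∈ Icc (0 : ℝ) T, z (y, t) ≤ z (x₁, t₁) := by
      intro y t ht
      rcases le_total R ‖y‖ with h | h
      · exact (hfar y h t ht).le.trans hz₁.le
      · exact hmax (mk_mem_prod (mem_closedBall_zero_iff.2 h) ht)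
    have hb₁ : ε ≤ ε * barrier p (2 * lam') x₁ :=
      le_mul_of_one_le_right hε.le (one_le_barrier p hβ0 x₁)
    simp only at ht₁
    have ht₁0 : 0 < t₁ := by
      refine ht₁.1.lt_of_ne fun h => ?_
      simp only [hz, ← h, hu0, mul_zero, Complex.zero_re] at hz₁
      linarith
    have ht₁' : t₁ ∈ Ioc (0 : ℝ) T := ⟨ht₁0, ht₁.2⟩
    set e : ℂ := ((Real.exp (-M * t₁) : ℝ) : ℂ) * c with he
    have hder : HasDerivAt (fun t => (((Real.exp (-M * t) : ℝ) : ℂ) * c * u x₁ t).re)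
        ((e * deriv (u x₁) t₁).re - M * (e * u x₁ t₁).re) t₁ := by
      have h1 : HasDerivAt (fun t : ℝ => Real.exp (-M * t)) (Real.exp (-M * t₁) * (-M)) t₁ := by
        simpa using ((hasDerivAt_id t₁).const_mul (-M)).exp
      have h2 := ((h1.ofReal_comp.mul_const c).mul (hudiff x₁ t₁ ht₁').hasDerivAt)
      have h3 := Complex.reCLM.hasFDerivAt.comp_hasDerivAt t₁ h2
      refine h3.congr_deriv ?_
      rw [Complex.reCLM_apply, ← Complex.re_ofReal_mul M, ← Complex.sub_re]
      congr 1
      rw [he]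
      push_cast
      ring
    have hder0 := nonneg_of_hasDerivAt_of_forall_le hder ht₁0 fun r hr => by
      have := hmax' x₁ r ⟨hr.1.le, hr.2.le.trans ht₁.2⟩
      simp only [hz] at this
      linarith
    have hmaxx : ∀ y, (e * u y t₁).re - ε * barrier p (2 * lam') y ≤
        (e * u x₁ t₁).re - ε * barrier p (2 * lam') x₁ := fun y => hmax' y t₁ ht₁
    have hv : ε < (e * u x₁ t₁).re := by
      have : 0 < (e * u x₁ t₁).re - ε * barrier p (2 * lam') x₁ := hz₁
      linarith
    have hA0K : -(ε * (bA0 * K0)) ≤ A0 x₁ t₁ * (e * fop p μ a α (fun y => u y t₁) x₁).re := by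
      have h1 := hK0' (hudom t₁ ht₁).1.1.continuous hδ (huCδ t₁ ht₁).1 (huCδ t₁ ht₁).2 e ε x₁
        hε.le hmaxx
      have h2 := mul_le_mul_of_nonneg_left h1 (hA0pos x₁ t₁ ht₁)
      have h3 := mul_le_mul_of_nonneg_right ((le_abs_self _).trans (hbA0 x₁ t₁ ht₁))
        (mul_nonneg hε.le hK0)
      linarith
    have hAK : -(ε * ∑ k, bA k * K k) ≤
        ∑ k, A k x₁ t₁ * (e * fop p μ a (αs k) (fun y => u y t₁) x₁).re := by
      rw [Finset.mul_sum, ← Finset.sum_neg_distrib]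
      exact Finset.sum_le_sum fun k _ => hK' k ht₁ e ε x₁ hε.le hmaxx
    have heq : (e * deriv (u x₁) t₁).re + A0 x₁ t₁ * (e * fop p μ a α (fun y => u y t₁) x₁).re +
        ∑ k, A k x₁ t₁ * (e * fop p μ a (αs k) (fun y => u y t₁) x₁).re +
        B x₁ t₁ * (e * u x₁ t₁).re = 0 := by
      have h := congrArg (fun w => (e * w).re) (hueq x₁ t₁ ht₁')
      simp only [mul_add, Finset.mul_sum, Complex.add_re, Complex.re_sum, mul_zero,
        Complex.zero_re, mul_left_comm e, Complex.re_ofReal_mul] at h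
      exact h
    have hB : -bB ≤ B x₁ t₁ := (abs_le.1 (hbB x₁ t₁ ht₁)).1
    have hBv := mul_le_mul_of_nonneg_right hB (hε.le.trans hv.le)
    have hSv := mul_le_mul_of_nonneg_left hv.le hS0
    nlinarith
  intro x t ht
  have hlim : (((Real.exp (-M * t) : ℝ) : ℂ) * (starRingEnd ℂ) (u x t) * u x t).re ≤ 0 := by
    refine le_of_forall_pos_le_add fun η hη => ?_
    have hb : 0 < barrier p (2 * lam') x := zero_lt_one.trans_le (one_le_barrier p hβ0 x)
    have h := hbound ((starRingEnd ℂ) (u x t)) (η / barrier p (2 * lam') x) (by positivity) x t ht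
    rw [div_mul_cancel₀ _ hb.ne'] at h
    linarith
  rw [mul_assoc, Complex.re_ofReal_mul, mul_comm ((starRingEnd ℂ) (u x t)), Complex.mul_conj,
    Complex.ofReal_re] at hlim
  exact Complex.normSq_eq_zero.1
    (le_antisymm (nonpos_of_mul_nonpos_right hlim (Real.exp_pos _)) (Complex.normSq_nonneg _))

end PadicParabolic
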